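/- arXiv:1802.08828 — 9 statements merged into one kernel-verified Lean document; each statement's English description precedes it below -/
import Mathlib

section
/- Let n ≥ 1 and let α : Fin n → (Fin (n-1) → ℤ) be a family of n integer weight vectors such that every n-1 of them are linearly independent over ℚ (general position). Let the torus T^{n-1} = (Fin (n-1) → Circle) act continuously on ℂ^n = (Fin n → ℂ) by (t • z) i = (∏ j, (t j)^(α i j)) * z i. Then the orbit space ℂ^n / T^{n-1} of this action is homeomorphic to the Euclidean space ℝ^{n+1} = (Fin (n+1) → ℝ). -/
open scoped BigOperators

/-- The homomorphism `T^{n-1} → T^n` given by an integer weight matrix `α`;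
through it, `T^{n-1}` acts on `ℂ^n` by `(t • z) i = (∏ j, (t j)^(α i j)) * z i`. -/
noncomputable def weightHom {n : ℕ} (α : Fin n → Fin (n - 1) → ℤ) :
    (Fin (n - 1) → Circle) →* (Fin n → Circle) where
  toFun t := fun i => ∏ j, t j ^ α i j
  map_one' := by funext i; simp
  map_mul' a b := by
    funext i
    show (∏ j, (a j * b j) ^ α i j) = (∏ j, a j ^ α i j) * ∏ j, b j ^ α i j
    simp [mul_zpow, Finset.prod_mul_distrib]

/-- Weights in general position satisfy an integer relation with nowhere vanishing coprime
coefficients. -/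
theorem exists_primitive_relation {m : ℕ} (α : Fin (m + 1) → Fin m → ℤ)
    (hgen : ∀ i, LinearIndependent ℚ
      (fun k : {j : Fin (m + 1) // j ≠ i} => fun l => (α k.1 l : ℚ))) :
    ∃ c k : Fin (m + 1) → ℤ, (∀ l, ∑ i, c i * α i l = 0) ∧ (∀ i, c i ≠ 0) ∧
      ∑ i, k i * c i = 1 := by
  have hdep : ¬ LinearIndependent ℤ α := fun h => by
    have := h.fintype_card_le_finrank
    simp at this
  obtain ⟨b, hb, i₀, hi₀⟩ := Fintype.not_linearIndependent_iff.1 hdep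
  obtain ⟨c, hbc, hc⟩ := Finset.extract_gcd b (Finset.univ_nonempty (α := Fin (m + 1)))
  have hg : Finset.univ.gcd b ≠ 0 := fun h => hi₀ (Finset.gcd_eq_zero_iff.1 h i₀ (by simp))
  have hrel : ∀ l, ∑ i, c i * α i l = 0 := fun l => by
    have h := congrFun hb l
    simp only [Finset.sum_apply, Pi.smul_apply, smul_eq_mul, Pi.zero_apply] at h
    rw [Finset.sum_congr rfl fun i hi => by rw [hbc i hi, mul_assoc], ← Finset.mul_sum] at h
    exact (mul_eq_zero.1 h).resolve_left hg
  obtain ⟨k, hk⟩ := Finset.gcd_eq_sum_mul Finset.univ c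
  have hsum : ∑ i, k i * c i = 1 := by rw [← hc, hk]; simp [mul_comm]
  refine ⟨c, k, hrel, fun i hi => ?_, hsum⟩
  have hzero := Fintype.linearIndependent_iff.1 (hgen i) (fun j => (c j.1 : ℚ)) (by
    ext l
    have h := hrel l
    rw [← Fintype.sum_subtype_add_sum_subtype (fun j => j ≠ i)] at h
    have h' : ∑ x : {j // ¬ j ≠ i}, c x * α x l = 0 :=
      Finset.sum_eq_zero fun x _ => by rw [not_not.1 x.2, hi, zero_mul]
    rw [h', add_zero] at h
    simpa using congrArg (Int.cast : ℤ → ℚ) h)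
  have hall : ∀ j, c j = 0 := fun j => by
    by_cases hj : j = i
    · rw [hj, hi]
    · exact_mod_cast hzero ⟨j, hj⟩
  simp [hall] at hsum

/-- Over the reals, the column space of the weights is the whole orthogonal complement of the
relation. -/
theorem exists_real_preimage {m : ℕ} (α : Fin (m + 1) → Fin m → ℤ)
    (hgen : LinearIndependent ℚ
      (fun k : {j : Fin (m + 1) // j ≠ 0} => fun l => (α k.1 l : ℚ)))
    {c : Fin (m + 1) → ℤ} (hrel : ∀ l, ∑ i, c i * α i l = 0) (hc : c 0 ≠ 0)
    {θ : Fin (m + 1) → ℝ} (hθ : ∑ i, c i * θ i = 0) :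
    ∃ x : Fin m → ℝ, ∀ i, ∑ l, α i l * x l = θ i := by
  let A : Matrix (Fin m) (Fin m) ℚ := Matrix.of fun k l => (α k.succ l : ℚ)
  have hA : IsUnit A := Matrix.linearIndependent_rows_iff_isUnit.1
    (hgen.comp (fun k : Fin m => ⟨k.succ, k.succ_ne_zero⟩) fun a b h => by simpa using h)
  have hA' := hA.map (algebraMap ℚ ℝ).mapMatrix
  obtain ⟨x, hx⟩ := Matrix.mulVec_surjective_iff_isUnit.2 hA' fun k => θ k.succ
  have hsucc : ∀ k : Fin m, ∑ l, α k.succ l * x l = θ k.succ := fun k => by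
    simpa [A, Matrix.mulVec, dotProduct] using congrFun hx k
  refine ⟨x, Fin.cases ?_ hsucc⟩
  have htot : ∑ i, (c i : ℝ) * ∑ l, α i l * x l = 0 := by
    simp_rw [Finset.mul_sum]
    rw [Finset.sum_comm]
    refine Finset.sum_eq_zero fun l _ => ?_
    simp_rw [← mul_assoc]
    rw [← Finset.sum_mul]
    have := congrArg (Int.cast : ℤ → ℝ) (hrel l)
    push_cast at this
    rw [this, zero_mul]
  rw [← hθ, Fin.sum_univ_succ, Fin.sum_univ_succ] at htot
  simp_rw [hsucc] at htot
  exact mul_left_cancel₀ (Int.cast_ne_zero.2 hc) (add_right_cancel htot)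

theorem Circle.exp_sum {ι : Type*} (s : Finset ι) (f : ι → ℝ) :
    Circle.exp (∑ i ∈ s, f i) = ∏ i ∈ s, Circle.exp (f i) := by
  classical
  induction s using Finset.induction_on with
  | empty => simp
  | insert a s ha ih => rw [Finset.sum_insert ha, Finset.prod_insert ha, Circle.exp_add, ih]

theorem Finset.prod_zpow_eq_zpow_sum {ι G : Type*} [CommGroup G] (s : Finset ι) (f : ι → ℤ)
    (a : G) : ∏ i ∈ s, a ^ f i = a ^ ∑ i ∈ s, f i := by
  classical
  induction s using Finset.induction_on with
  | empty => simp
  | insert b s hb ih => rw [Finset.prod_insert hb, Finset.sum_insert hb, zpow_add, ih]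

/-- The image of the torus is the kernel of the character given by the primitive relation. -/
theorem mem_range_weightHom_iff {m : ℕ} (α : Fin (m + 1) → Fin m → ℤ)
    (hgen : LinearIndependent ℚ
      (fun k : {j : Fin (m + 1) // j ≠ 0} => fun l => (α k.1 l : ℚ)))
    {c k : Fin (m + 1) → ℤ} (hrel : ∀ l, ∑ i, c i * α i l = 0) (hc : c 0 ≠ 0)
    (hk : ∑ i, k i * c i = 1) (t : Fin (m + 1) → Circle) :
    t ∈ (@weightHom (m + 1) α).range ↔ ∏ i, t i ^ c i = 1 := by
  constructor
  · rintro ⟨s, rfl⟩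
    change ∏ i, (∏ j : Fin m, s j ^ α i j) ^ c i = 1
    simp_rw [← Finset.prod_zpow, ← zpow_mul]
    rw [Finset.prod_comm]
    refine Finset.prod_eq_one fun l _ => ?_
    rw [Finset.prod_zpow_eq_zpow_sum, Finset.sum_congr rfl fun i _ => mul_comm _ _, hrel, zpow_zero]
  · intro ht
    have hexp : Circle.exp (∑ i, c i * Complex.arg (t i)) = 1 := by
      rw [← ht, Circle.exp_sum]
      simp [Circle.exp_arg]
    obtain ⟨N, hN⟩ := Circle.exp_eq_one.1 hexp
    obtain ⟨x, hx⟩ := exists_real_preimage α hgen hrel hc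
      (θ := fun i => Complex.arg (t i) - (N * k i : ℤ) * (2 * Real.pi)) (by
        have := congrArg (Int.cast : ℤ → ℝ) hk
        push_cast at this
        calc _ = ∑ i, (c i * Complex.arg (t i) - N * (2 * Real.pi) * (k i * c i)) :=
              Finset.sum_congr rfl fun i _ => by push_cast; ring
          _ = 0 := by rw [Finset.sum_sub_distrib, ← Finset.mul_sum, this, hN]; ring)
    refine ⟨fun l => Circle.exp (x l), ?_⟩
    funext i
    change ∏ l : Fin m, Circle.exp (x l) ^ α i l = t i
    simp_rw [← Circle.exp_intCast_mul]
    rw [← Circle.exp_sum, hx, Circle.exp_sub, Circle.exp_int_mul_two_pi, div_one, Circle.exp_arg]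

theorem Circle.exists_zpow_eq (u : Circle) {k : ℤ} (hk : k ≠ 0) : ∃ v : Circle, v ^ k = u := by
  refine ⟨Circle.exp (Complex.arg u / k), ?_⟩
  rw [← Circle.exp_intCast_mul, mul_div_cancel₀ _ (Int.cast_ne_zero.2 hk), Circle.exp_arg]

theorem Circle.prod_ite_zpow {ι : Type*} [Fintype ι] [DecidableEq ι] (c : ι → ℤ) (i : ι)
    (v : Circle) : ∏ j, (if j = i then v else 1) ^ c j = v ^ c i := by
  rw [Finset.prod_eq_single i (fun j _ hj => by rw [if_neg hj, one_zpow]) (by simp), if_pos rfl]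

section Monomial

variable {ι : Type*} [Fintype ι] [Nonempty ι] {a : ι → ℕ}

theorem prod_pow_lt_prod_pow_of_lt (ha : ∀ i, a i ≠ 0) {r s : ι → ℝ} (hr : ∀ i, 0 ≤ r i)
    (hrs : ∀ i, r i < s i) : ∏ i, r i ^ a i < ∏ i, s i ^ a i := by
  by_cases h : ∃ i, r i = 0
  · obtain ⟨i, hi⟩ := h
    rw [Finset.prod_eq_zero (Finset.mem_univ i) (by rw [hi, zero_pow (ha i)])]
    exact Finset.prod_pos fun j _ => pow_pos ((hr j).trans_lt (hrs j)) _
  · push Not at h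
    exact Finset.prod_lt_prod_of_nonempty
      (fun i _ => pow_pos (lt_of_le_of_ne (hr i) (h i).symm) _)
      (fun i _ => pow_lt_pow_left₀ (hrs i) (hr i) (ha i)) Finset.univ_nonempty

theorem le_prod_pow_of_forall_le (ha : ∀ i, a i ≠ 0) {r : ι → ℝ} {x : ℝ} (hx : 1 ≤ x)
    (hr : ∀ i, x ≤ r i) : x ≤ ∏ i, r i ^ a i := by
  have h1 : ∀ i, 1 ≤ r i ^ a i := fun i => one_le_pow₀ (hx.trans (hr i))
  obtain ⟨i⟩ := ‹Nonempty ι›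
  calc x ≤ r i := hr i
    _ ≤ r i ^ a i := le_self_pow₀ (hx.trans (hr i)) (ha i)
    _ = ∏ j ∈ {i}, r j ^ a j := by simp
    _ ≤ ∏ j, r j ^ a j := Finset.prod_le_prod_of_subset_of_one_le (Finset.subset_univ _)
        (fun j _ => zero_le_one.trans (h1 j)) (fun j _ _ => h1 j)

/-- On the nonnegative orthant, coordinate differences together with a monomial involving every
variable separate points. -/
theorem eq_of_sub_eq_of_prod_pow_eq (ha : ∀ i, a i ≠ 0) {r s : ι → ℝ} (hr : ∀ i, 0 ≤ r i)
    (hs : ∀ i, 0 ≤ s i) (hsub : ∀ i j, r i - r j = s i - s j)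
    (hprod : ∏ i, r i ^ a i = ∏ i, s i ^ a i) : r = s := by
  obtain ⟨i₀⟩ := ‹Nonempty ι›
  have : Nonempty ι := ⟨i₀⟩
  rcases lt_trichotomy (r i₀) (s i₀) with h | h | h
  · exact absurd hprod (prod_pow_lt_prod_pow_of_lt ha hr fun i => by linarith [hsub i i₀]).ne
  · funext i
    linarith [hsub i i₀]
  · exact absurd hprod (prod_pow_lt_prod_pow_of_lt ha hs fun i => by linarith [hsub i i₀]).ne'

theorem exists_nonneg_sub_eq_prod_pow_eq (ha : ∀ i, a i ≠ 0) (e : ι → ℝ) {y : ℝ} (hy : 0 ≤ y) :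
    ∃ r : ι → ℝ, (∀ i, 0 ≤ r i) ∧ (∀ i j, r i - r j = e i - e j) ∧ ∏ i, r i ^ a i = y := by
  obtain ⟨i₀, hi₀⟩ := Finite.exists_min e
  have hcont : Continuous fun x : ℝ => ∏ i, (x + (e i - e i₀)) ^ a i := by fun_prop
  have hzero : ∏ i, (0 + (e i - e i₀)) ^ a i = 0 :=
    Finset.prod_eq_zero (Finset.mem_univ i₀) (by simp [ha i₀])
  have hle : y ≤ ∏ i, (max 1 y + (e i - e i₀)) ^ a i :=
    (le_max_right 1 y).trans <| le_prod_pow_of_forall_le ha (le_max_left _ _) fun i => by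
      linarith [hi₀ i]
  obtain ⟨x, hx, hxy⟩ := intermediate_value_Icc (zero_le_one.trans (le_max_left 1 y))
    hcont.continuousOn ⟨hzero.trans_le hy, hle⟩
  exact ⟨fun i => x + (e i - e i₀), fun i => by linarith [hi₀ i, hx.1], fun i j => by ring, hxy⟩

end Monomial

/-- The `k`-th power of `z`, with negative powers replaced by powers of the conjugate. -/
noncomputable def conjPow (k : ℤ) (z : ℂ) : ℂ :=
  if 0 ≤ k then z ^ k.natAbs else star z ^ k.natAbs

theorem continuous_conjPow (k : ℤ) : Continuous (conjPow k) := by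
  unfold conjPow
  split_ifs <;> fun_prop

theorem norm_conjPow (k : ℤ) (z : ℂ) : ‖conjPow k z‖ = ‖z‖ ^ k.natAbs := by
  unfold conjPow
  split_ifs <;> simp

theorem conjPow_ofReal (k : ℤ) (r : ℝ) : conjPow k r = (r : ℂ) ^ k.natAbs := by
  simp [conjPow]

theorem conjPow_circle_mul (k : ℤ) (u : Circle) (z : ℂ) :
    conjPow k (u * z) = (u ^ k : Circle) * conjPow k z := by
  unfold conjPow
  split_ifs with h
  · obtain ⟨n, rfl⟩ := Int.eq_ofNat_of_zero_le h
    simp [mul_pow]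
  · obtain ⟨n, rfl⟩ := Int.eq_negSucc_of_lt_zero (not_le.1 h)
    rw [star_mul', mul_pow, zpow_negSucc, ← inv_pow, Circle.coe_pow, Circle.coe_inv_eq_conj]
    rfl

theorem Complex.exists_circle_mul_eq {z w : ℂ} (h : ‖z‖ = ‖w‖) : ∃ u : Circle, u * z = w := by
  by_cases hz : z = 0
  · refine ⟨1, ?_⟩
    rw [hz, norm_zero] at h
    simp [hz, norm_eq_zero.1 h.symm]
  · refine ⟨⟨w / z, mem_sphere_zero_iff_norm.2 ?_⟩, div_mul_cancel₀ w hz⟩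
    rw [norm_div, h, div_self (h ▸ norm_ne_zero_iff.2 hz)]

/-- The invariants of the torus action with primitive relation `c`: differences of moduli, and the
twisted monomial with exponents `c`. -/
noncomputable def orbitInvariant {m : ℕ} (c : Fin (m + 1) → ℤ) (z : Fin (m + 1) → ℂ) :
    (Fin m → ℝ) × ℂ :=
  (fun i => ‖z i.succ‖ - ‖z 0‖, ∏ i, conjPow (c i) (z i))

theorem continuous_orbitInvariant {m : ℕ} (c : Fin (m + 1) → ℤ) :
    Continuous (orbitInvariant c) := by
  have := continuous_conjPow
  unfold orbitInvariant
  fun_prop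

theorem prod_conjPow_circle_mul {m : ℕ} (c : Fin (m + 1) → ℤ) (t : Fin (m + 1) → Circle)
    (z : Fin (m + 1) → ℂ) :
    ∏ i, conjPow (c i) (t i * z i) = (∏ i, t i ^ c i : Circle) * ∏ i, conjPow (c i) (z i) := by
  have h : ((∏ i, t i ^ c i : Circle) : ℂ) = ∏ i, ((t i ^ c i : Circle) : ℂ) :=
    map_prod Circle.coeHom _ _
  simp_rw [conjPow_circle_mul]
  rw [Finset.prod_mul_distrib, h]

theorem orbitInvariant_eq_iff {m : ℕ} {c : Fin (m + 1) → ℤ} (hc : ∀ i, c i ≠ 0)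
    {z w : Fin (m + 1) → ℂ} :
    orbitInvariant c z = orbitInvariant c w ↔
      ∃ t : Fin (m + 1) → Circle, ∏ i, t i ^ c i = 1 ∧ ∀ i, t i * z i = w i := by
  constructor
  · intro h
    obtain ⟨hsub, hprod⟩ := Prod.ext_iff.1 h
    have hsub' : ∀ i, ‖z i‖ - ‖z 0‖ = ‖w i‖ - ‖w 0‖ :=
      Fin.cases (by simp) fun i => congrFun hsub i
    have hnorm : (fun i => ‖z i‖) = fun i => ‖w i‖ :=
      eq_of_sub_eq_of_prod_pow_eq (a := fun i => (c i).natAbs)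
        (fun i => Int.natAbs_ne_zero.2 (hc i)) (fun i => norm_nonneg _) (fun i => norm_nonneg _)
        (fun i j => by linarith [hsub' i, hsub' j]) (by
          have := congrArg norm hprod
          simpa [orbitInvariant, norm_prod, norm_conjPow] using this)
    choose u hu using fun i => Complex.exists_circle_mul_eq (congrFun hnorm i)
    by_cases hz : ∃ i, z i = 0
    · obtain ⟨i, hi⟩ := hz
      obtain ⟨v, hv⟩ := Circle.exists_zpow_eq (∏ j, u j ^ c j)⁻¹ (hc i)
      refine ⟨fun j => (if j = i then v else 1) * u j, ?_, fun j => ?_⟩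
      · simp_rw [mul_zpow]
        rw [Finset.prod_mul_distrib, Circle.prod_ite_zpow, hv, inv_mul_cancel]
      · by_cases hj : j = i
        · subst hj
          simp [← hu j, hi]
        · simp [hj, hu j]
    · push Not at hz
      refine ⟨u, ?_, hu⟩
      have hne : ∏ i, conjPow (c i) (z i) ≠ 0 := Finset.prod_ne_zero_iff.2 fun i _ => by
        rw [← norm_ne_zero_iff, norm_conjPow]
        exact pow_ne_zero _ (norm_ne_zero_iff.2 (hz i))
      have h1 := prod_conjPow_circle_mul c u z
      simp_rw [hu] at h1
      refine Circle.ext (mul_right_cancel₀ hne ?_)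
      rw [← h1, Circle.coe_one, one_mul]
      exact hprod.symm
  · rintro ⟨t, ht, htz⟩
    obtain rfl : (fun i => (t i : ℂ) * z i) = w := funext htz
    refine Prod.ext (funext fun i => ?_) ?_
    · simp [orbitInvariant, Circle.norm_coe]
    · change _ = ∏ i, conjPow (c i) (t i * z i)
      rw [prod_conjPow_circle_mul, ht, Circle.coe_one, one_mul]
      rfl

theorem orbitInvariant_surjective {m : ℕ} {c : Fin (m + 1) → ℤ} (hc : ∀ i, c i ≠ 0) :
    Function.Surjective (orbitInvariant c) := by
  rintro ⟨d, w⟩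
  obtain ⟨r, hr, hsub, hprod⟩ := exists_nonneg_sub_eq_prod_pow_eq
    (a := fun i => (c i).natAbs) (fun i => Int.natAbs_ne_zero.2 (hc i))
    (Fin.cons 0 d : Fin (m + 1) → ℝ) (norm_nonneg w)
  obtain ⟨u, hu⟩ := Complex.exists_circle_mul_eq (z := (‖w‖ : ℂ)) (w := w) (by simp)
  obtain ⟨v, hv⟩ := Circle.exists_zpow_eq u (hc 0)
  refine ⟨fun i => ((if i = 0 then v else 1 : Circle) : ℂ) * r i,
    Prod.ext (funext fun i => ?_) ?_⟩
  · have := hsub i.succ 0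
    simpa [orbitInvariant, Circle.norm_coe, abs_of_nonneg (hr _)] using this
  · change ∏ i, conjPow (c i) (_ * (r i : ℂ)) = w
    rw [prod_conjPow_circle_mul, Circle.prod_ite_zpow, hv, ← hu, ← hprod]
    simp [conjPow_ofReal]

theorem norm_le_of_orbitInvariant {m : ℕ} {c : Fin (m + 1) → ℤ} (hc : ∀ i, c i ≠ 0)
    (z : Fin (m + 1) → ℂ) : ‖z‖ ≤ 1 + 3 * ‖orbitInvariant c z‖ := by
  set R := ‖orbitInvariant c z‖ with hR
  have hR0 : 0 ≤ R := norm_nonneg _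
  have hsub : ∀ i, |‖z i‖ - ‖z 0‖| ≤ R := Fin.cases (by simpa using hR0) fun i =>
    (norm_le_pi_norm (orbitInvariant c z).1 i).trans (norm_fst_le _)
  have hprod : ∏ i, ‖z i‖ ^ (c i).natAbs ≤ R := by
    have : ‖∏ i, conjPow (c i) (z i)‖ ≤ R := norm_snd_le (orbitInvariant c z)
    simpa only [norm_prod, norm_conjPow] using this
  obtain ⟨j, hj⟩ := Finite.exists_min fun i => ‖z i‖
  have hmin : ‖z j‖ ≤ 1 + R := by
    by_contra! h
    have := le_prod_pow_of_forall_le (a := fun i => (c i).natAbs)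
      (fun i => Int.natAbs_ne_zero.2 (hc i)) (x := ‖z j‖) (by linarith) hj
    linarith
  refine (pi_norm_le_iff_of_nonneg (by positivity)).2 fun i => ?_
  linarith [abs_le.1 (hsub i), abs_le.1 (hsub j)]

theorem isClosedMap_orbitInvariant {m : ℕ} {c : Fin (m + 1) → ℤ} (hc : ∀ i, c i ≠ 0) :
    IsClosedMap (orbitInvariant c) := by
  refine (isProperMap_iff_tendsto_cocompact.2 ⟨continuous_orbitInvariant c, ?_⟩).isClosedMap
  rw [← Metric.cobounded_eq_cocompact, ← Metric.cobounded_eq_cocompact,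
    ← tendsto_norm_atTop_iff_cobounded]
  have h : Filter.Tendsto (fun z : Fin (m + 1) → ℂ => 3⁻¹ * (‖z‖ - 1))
      (Bornology.cobounded _) Filter.atTop :=
    (Filter.tendsto_atTop_add_const_right _ (-1)
      tendsto_norm_cobounded_atTop).const_mul_atTop (by norm_num)
  exact Filter.tendsto_atTop_mono (fun z => by linarith [norm_le_of_orbitInvariant hc z]) h

/-- for a complexity-one torus representation in general position
(every `n-1` of the `n` weights are linearly independent over `ℚ`), the orbit space
`ℂ^n / T^{n-1}` is homeomorphic to `ℝ^{n+1}`.  The orbit space of the `T^{n-1}`-action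
given by the weights `α` is the quotient of `ℂ^n` by the orbits of the subgroup
`(weightHom α).range ⊆ T^n`, where `T^n` acts coordinatewise. -/
theorem orbit_space_general_position_rep_homeomorph_euclidean
    (n : ℕ) (hn : 1 ≤ n) (α : Fin n → Fin (n - 1) → ℤ)
    (hgen : ∀ i : Fin n,
      LinearIndependent ℚ (fun k : {j : Fin n // j ≠ i} => fun l => (α k.1 l : ℚ))) :
    Nonempty (Quotient (MulAction.orbitRel ↥(weightHom α).range (Fin n → ℂ))
      ≃ₜ (Fin (n + 1) → ℝ)) := by
  obtain ⟨m, rfl⟩ := Nat.exists_eq_add_of_le' hn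
  obtain ⟨c, k, hrel, hc, hk⟩ := exists_primitive_relation α hgen
  have hrange := mem_range_weightHom_iff α (hgen 0) hrel (hc 0) hk
  have hker : MulAction.orbitRel ↥(weightHom α).range (Fin (m + 1) → ℂ) =
      Setoid.ker (orbitInvariant c) := by
    ext z w
    rw [MulAction.orbitRel_apply, Setoid.ker_def, eq_comm, orbitInvariant_eq_iff hc]
    constructor
    · rintro ⟨⟨t, ht⟩, rfl⟩
      exact ⟨t, (hrange t).1 ht, fun i => rfl⟩
    · rintro ⟨t, ht, htw⟩
      exact ⟨⟨t, (hrange t).2 ht⟩, funext htw⟩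
  rw [hker]
  have hquot := (isClosedMap_orbitInvariant hc).isQuotientMap (continuous_orbitInvariant c)
    (orbitInvariant_surjective hc)
  have hrank : Module.finrank ℝ ((Fin m → ℝ) × ℂ) =
      Module.finrank ℝ (Fin (m + 1 + 1) → ℝ) := by simp
  exact ⟨(hquot.homeomorph (f := ⟨_, continuous_orbitInvariant c⟩)).trans
    (ContinuousLinearEquiv.ofFinrankEq hrank).toHomeomorph⟩
end

section
/- Let n ≥ 1 and c : Fin n → ℤ with c i ≠ 0 for every i. Then the following are equivalent: (1) for every point z ∈ ℂ^n, the stabilizer subgroup {t ∈ T'_c : t • z = z} is a connected subspace of T'_c; (2) for every i, c i = 1 or c i = -1. -/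
open scoped BigOperators

noncomputable def torusChar {n : ℕ} (c : Fin n → ℤ) : (Fin n → Circle) →* Circle where
  toFun t := ∏ i, t i ^ c i
  map_one' := by simp
  map_mul' a b := by simp [mul_zpow, Finset.prod_mul_distrib]

noncomputable def torusKer {n : ℕ} (c : Fin n → ℤ) : Subgroup (Fin n → Circle) :=
  (torusChar c).ker

theorem torusChar_apply {n : ℕ} (c : Fin n → ℤ) (t : Fin n → Circle) :
    torusChar c t = ∏ i, t i ^ c i := rfl

theorem mem_torusKer {n : ℕ} {c : Fin n → ℤ} {t : Fin n → Circle} :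
    t ∈ torusKer c ↔ torusChar c t = 1 := Iff.rfl

theorem continuous_torusChar {n : ℕ} (c : Fin n → ℤ) : Continuous (torusChar c) := by
  change Continuous fun t : Fin n → Circle => ∏ i, t i ^ c i
  fun_prop

theorem torusChar_mulSingle {n : ℕ} (c : Fin n → ℤ) (i : Fin n) (a : Circle) :
    torusChar c (Pi.mulSingle i a) = a ^ c i := by
  rw [torusChar_apply, Finset.prod_eq_single i]
  · simp
  · intro j _ hj
    simp [Pi.mulSingle_eq_of_ne hj]
  · simp

theorem torus_smul_eq_self_iff {n : ℕ} {t : Fin n → Circle} {z : Fin n → ℂ} :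
    t • z = z ↔ ∀ i, z i ≠ 0 → t i = 1 := by
  rw [funext_iff]
  refine forall_congr' fun i => ?_
  rw [Pi.smul_apply', Circle.smul_def, smul_eq_mul, mul_left_eq_self₀, Circle.coe_eq_one]
  tauto

theorem mem_stabilizer_torusKer {n : ℕ} {c : Fin n → ℤ} {z : Fin n → ℂ} {t : torusKer c} :
    t ∈ MulAction.stabilizer (torusKer c) z ↔ ∀ i, z i ≠ 0 → (t : Fin n → Circle) i = 1 := by
  rw [MulAction.mem_stabilizer_iff, Subgroup.smul_def, torus_smul_eq_self_iff]

/-- If `c i = ±1` for some `i` with `z i = 0`, the stabilizer of `z` is a continuous image of the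
torus. -/
theorem connectedSpace_stabilizer_of_isUnit {n : ℕ} {c : Fin n → ℤ} {z : Fin n → ℂ} {i : Fin n}
    (hi : c i = 1 ∨ c i = -1) (hz : z i = 0) :
    ConnectedSpace (MulAction.stabilizer (torusKer c) z) := by
  classical
  let w : (Fin n → Circle) → Fin n → Circle := fun u j => if z j = 0 then u j else 1
  let F : (Fin n → Circle) → Fin n → Circle := fun u =>
    w u * Pi.mulSingle i (torusChar c (w u) ^ (-c i))
  have hw : Continuous w := by
    refine continuous_pi fun j => ?_
    by_cases h : z j = 0 <;> simp only [w, h, if_true, if_false] <;> fun_prop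
  have hF : Continuous F :=
    hw.mul ((continuous_mulSingle i).comp (((continuous_torusChar c).comp hw).zpow _))
  have hker (u) : F u ∈ torusKer c := by
    rw [mem_torusKer, map_mul, torusChar_mulSingle]
    rcases hi with h | h <;> simp [h]
  have hstab (u) : (⟨F u, hker u⟩ : torusKer c) ∈ MulAction.stabilizer (torusKer c) z := by
    refine mem_stabilizer_torusKer.2 fun j hj => ?_
    have hji : j ≠ i := by rintro rfl; exact hj hz
    simp [F, w, hj, Pi.mulSingle_eq_of_ne hji]
  let G : (Fin n → Circle) → MulAction.stabilizer (torusKer c) z := fun u =>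
    ⟨⟨F u, hker u⟩, hstab u⟩
  have hG : Continuous G := (hF.subtype_mk _).subtype_mk _
  refine Function.Surjective.connectedSpace (f := G) (fun t => ⟨t.1.1, ?_⟩) hG
  have hwt : w t.1.1 = t.1.1 := by
    funext j
    by_cases h : z j = 0
    · simp [w, h]
    · simp [w, h, mem_stabilizer_torusKer.1 t.2 j h]
  refine Subtype.ext (Subtype.ext ?_)
  change F t.1.1 = t.1.1
  simp [F, hwt, mem_torusKer.1 t.1.2]

theorem connectedSpace_stabilizer_of_forall_ne_zero {n : ℕ} {c : Fin n → ℤ} {z : Fin n → ℂ}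
    (hz : ∀ i, z i ≠ 0) : ConnectedSpace (MulAction.stabilizer (torusKer c) z) := by
  have h (t : MulAction.stabilizer (torusKer c) z) : t = 1 :=
    Subtype.ext (Subtype.ext (funext fun i => mem_stabilizer_torusKer.1 t.2 i (hz i)))
  have : Subsingleton (MulAction.stabilizer (torusKer c) z) := ⟨fun a b => (h a).trans (h b).symm⟩
  exact { toNonempty := ⟨1⟩ }

theorem Circle.finite_setOf_zpow_eq_one {k : ℤ} (hk : k ≠ 0) :
    {a : Circle | a ^ k = 1}.Finite := by
  have hk' : 0 < k.natAbs := Int.natAbs_pos.2 hk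
  refine Set.Finite.of_finite_image (f := ((↑) : Circle → ℂ)) ?_ Circle.coe_injective.injOn
  refine (Polynomial.nthRoots k.natAbs (1 : ℂ)).toFinset.finite_toSet.subset ?_
  rintro _ ⟨a, ha, rfl⟩
  have ha' : a ^ k.natAbs = 1 := by
    rcases Int.natAbs_eq k with h | h <;> rw [Set.mem_ofPred_eq, h] at ha <;> simpa using ha
  simp [Polynomial.mem_nthRoots hk', ← Circle.coe_pow, ha']

theorem eq_one_or_neg_one_of_connectedSpace_stabilizer {n : ℕ} {c : Fin n → ℤ} {i : Fin n}
    (hi : c i ≠ 0)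
    (h : ConnectedSpace (MulAction.stabilizer (torusKer c) (fun j => if j = i then (0 : ℂ) else 1))) :
    c i = 1 ∨ c i = -1 := by
  set z : Fin n → ℂ := fun j => if j = i then 0 else 1 with hz
  let e : MulAction.stabilizer (torusKer c) z → Circle := fun t => t.1.1 i
  have he : Continuous e :=
    (continuous_apply i).comp (continuous_subtype_val.comp continuous_subtype_val)
  have hsingle (t : MulAction.stabilizer (torusKer c) z) : t.1.1 = Pi.mulSingle i (e t) := by
    funext j
    by_cases hj : j = i
    · subst hj; simp [e]
    · rw [Pi.mulSingle_eq_of_ne hj]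
      exact mem_stabilizer_torusKer.1 t.2 j (by simp [hz, hj])
  have hfin : (Set.range e).Finite := by
    refine (Circle.finite_setOf_zpow_eq_one hi).subset ?_
    rintro _ ⟨t, rfl⟩
    rw [Set.mem_ofPred_eq, ← torusChar_mulSingle, ← hsingle]
    exact t.1.2
  have hsub : (Set.range e).Subsingleton := by
    by_contra hne
    exact (isPreconnected_range he).infinite_of_nontrivial (Set.not_subsingleton_iff.1 hne) hfin
  set a : Circle := Circle.exp (2 * Real.pi / c i) with ha
  have hci : (c i : ℝ) ≠ 0 := by exact_mod_cast hi
  have hak : a ^ c i = 1 := by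
    rw [ha, ← Circle.exp_zsmul, zsmul_eq_mul, mul_div_cancel₀ _ hci, Circle.exp_two_pi]
  let s : torusKer c := ⟨Pi.mulSingle i a, mem_torusKer.2 (by rw [torusChar_mulSingle, hak])⟩
  have hs : s ∈ MulAction.stabilizer (torusKer c) z := by
    refine mem_stabilizer_torusKer.2 fun j hj => ?_
    have hji : j ≠ i := by rintro rfl; simp [hz] at hj
    exact Pi.mulSingle_eq_of_ne (M := fun _ => Circle) hji a
  have ha1 : a = 1 := by
    simpa [e, s] using hsub ⟨⟨s, hs⟩, rfl⟩ ⟨1, rfl⟩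
  obtain ⟨m, hm⟩ := Circle.exp_eq_one.1 ha1
  have hmul : c i * m = 1 := by
    have hpi := Real.pi_ne_zero
    field_simp at hm
    have : (c i : ℝ) * m = 1 := by linarith
    exact_mod_cast this
  exact Int.isUnit_iff.1 (IsUnit.of_mul_eq_one _ hmul)

/-- the action of `T'_c` on `ℂ^n` has all stabilizers connected
iff every `c i` is `±1`. -/
theorem stabilizers_connected_iff_coeffs_pm_one
    (n : ℕ) (hn : 1 ≤ n) (c : Fin n → ℤ) (hc : ∀ i, c i ≠ 0) :
    (∀ z : Fin n → ℂ, ConnectedSpace ↥(MulAction.stabilizer ↥(torusKer c) z)) ↔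
      (∀ i, c i = 1 ∨ c i = -1) := by
  refine ⟨fun h i => eq_one_or_neg_one_of_connectedSpace_stabilizer (hc i) (h _), fun h z => ?_⟩
  by_cases hz : ∃ i, z i = 0
  · obtain ⟨i, hi⟩ := hz
    exact connectedSpace_stabilizer_of_isUnit (h i) hi
  · exact connectedSpace_stabilizer_of_forall_ne_zero (not_exists.1 hz)
end

section
/- Let c : Fin n → ℤ with c i ≠ 0 for every i, and let z ∈ ℂ^n be such that the zero set I = {i : z i = 0} is nonempty. Then the stabilizer of z in T'_c equals T'_c ∩ G_I, where G_I = {t ∈ T^n : t i = 1 for all i ∉ I} is the coordinate subtorus on I, and the space of connected components of this stabilizer (with its subspace topology) is finite with exactly gcd_{i ∈ I} |c i| elements. -/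
open scoped BigOperators
open scoped Classical

/-- The coordinate subtorus `G_I ⊆ T^n` on a set of indices `I`. -/
noncomputable def coordSubtorus {n : ℕ} (I : Set (Fin n)) : Subgroup (Fin n → Circle) where
  carrier := {t | ∀ i ∉ I, t i = 1}
  one_mem' := fun i _ => rfl
  mul_mem' := by
    intro a b ha hb i hi
    show a i * b i = 1
    rw [ha i hi, hb i hi, one_mul]
  inv_mem' := by
    intro a ha i hi
    show (a i)⁻¹ = 1
    rw [ha i hi, inv_one]

theorem Circle.exp_finsetSum_intCast_mul {ι : Type*} (s : Finset ι) (d : ι → ℤ) (θ : ι → ℝ) :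
    Circle.exp (∑ i ∈ s, d i * θ i) = ∏ i ∈ s, Circle.exp (θ i) ^ d i := by
  induction s using Finset.induction_on with
  | empty => simp
  | insert a s ha ih =>
    rw [Finset.sum_insert ha, Finset.prod_insert ha, Circle.exp_add, ih, Circle.exp_intCast_mul]

theorem Finset.zpow_sum {ι G : Type*} [CommGroup G] (s : Finset ι) (a : G) (k : ι → ℤ) :
    a ^ ∑ i ∈ s, k i = ∏ i ∈ s, a ^ k i := by
  induction s using Finset.induction_on with
  | empty => simp
  | insert j s hj ih => rw [Finset.sum_insert hj, Finset.prod_insert hj, zpow_add, ih]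

theorem Finset.natCast_gcd_natAbs {ι : Type*} (s : Finset ι) (c : ι → ℤ) :
    ((s.gcd fun i => (c i).natAbs : ℕ) : ℤ) = s.gcd c := by
  induction s using Finset.induction_on with
  | empty => simp
  | insert a s ha ih =>
    rw [Finset.gcd_insert, Finset.gcd_insert, ← ih, ← Int.coe_gcd]
    simp [Int.gcd, GCDMonoid.gcd]

/-- If the weights `d` admit a Bézout relation on `s`, the fibres of the character of weight `d`
on the coordinate subtorus on `s` are connected. -/
theorem isPreconnected_setOf_prod_zpow_eq {ι : Type*} (s : Finset ι) (b d : ι → ℤ)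
    (hbd : ∑ i ∈ s, d i * b i = 1) (ζ : Circle) :
    IsPreconnected {t : ι → Circle | (∀ i ∉ s, t i = 1) ∧ ∏ i ∈ s, t i ^ d i = ζ} := by
  have hbd' : ∑ i ∈ s, (d i : ℝ) * b i = 1 := by exact_mod_cast hbd
  obtain ⟨α, rfl⟩ : ∃ α, Circle.exp α = ζ := ⟨_, Circle.exp_arg ζ⟩
  have hconv : Convex ℝ {θ : ι → ℝ | (∀ i ∉ s, θ i = 0) ∧ ∑ i ∈ s, d i * θ i = α} := by
    rintro x ⟨hx, hxα⟩ y ⟨hy, hyα⟩ p q - - hpq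
    refine ⟨fun i hi => by simp [hx i hi, hy i hi], ?_⟩
    calc ∑ i ∈ s, (d i : ℝ) * (p • x + q • y) i
        = p * ∑ i ∈ s, d i * x i + q * ∑ i ∈ s, d i * y i := by
          rw [Finset.mul_sum, Finset.mul_sum, ← Finset.sum_add_distrib]
          refine Finset.sum_congr rfl fun i _ => ?_
          simp only [Pi.add_apply, Pi.smul_apply, smul_eq_mul]
          ring
      _ = α := by rw [hxα, hyα, ← add_mul, hpq, one_mul]
  have hcont : Continuous fun (θ : ι → ℝ) i => Circle.exp (θ i) := by fun_prop
  convert hconv.isPreconnected.image _ hcont.continuousOn using 1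
  ext t
  constructor
  · rintro ⟨ht, htα⟩
    have hexp : Circle.exp (∑ i ∈ s, d i * Complex.arg (t i)) = Circle.exp α := by
      rw [Circle.exp_finsetSum_intCast_mul, ← htα]
      simp only [Circle.exp_arg]
    obtain ⟨m, hm⟩ := Circle.exp_eq_exp.1 hexp
    refine ⟨fun i => if i ∈ s then Complex.arg (t i) - (b i * m : ℤ) * (2 * Real.pi) else 0,
      ⟨fun i hi => if_neg hi, ?_⟩, ?_⟩
    · calc _ = ∑ i ∈ s, ((d i : ℝ) * Complex.arg (t i) - d i * b i * (m * (2 * Real.pi))) :=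
            Finset.sum_congr rfl fun i hi => by
              simp only [if_pos hi]
              push_cast
              ring
        _ = α := by
            rw [Finset.sum_sub_distrib, ← Finset.sum_mul, hbd', hm]
            ring
    · funext i
      by_cases hi : i ∈ s
      · simp only [if_pos hi]
        rw [Circle.exp_sub, Circle.exp_int_mul_two_pi, div_one, Circle.exp_arg]
      · simp [hi, ht i hi]
  · rintro ⟨θ, ⟨hθ, hθα⟩, rfl⟩
    refine ⟨fun i hi => by simp [hθ i hi], ?_⟩
    rw [← Circle.exp_finsetSum_intCast_mul, hθα]

theorem Continuous.connectedComponentsLift_bijective {X Y : Type*} [TopologicalSpace X]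
    [TopologicalSpace Y] [TotallyDisconnectedSpace Y] {f : X → Y} (hf : Continuous f)
    (hsurj : Function.Surjective f) (hfib : ∀ y, IsPreconnected (f ⁻¹' {y})) :
    Function.Bijective hf.connectedComponentsLift := by
  constructor
  · intro x y
    obtain ⟨x, rfl⟩ := ConnectedComponents.surjective_coe x
    obtain ⟨y, rfl⟩ := ConnectedComponents.surjective_coe y
    intro hxy
    simp only [Continuous.connectedComponentsLift_apply_coe] at hxy
    rw [ConnectedComponents.coe_eq_coe']
    exact (hfib (f y)).subset_connectedComponent rfl hxy
  · intro y
    obtain ⟨x, rfl⟩ := hsurj y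
    exact ⟨x, by simp⟩

/-- The `g`-th roots of unity in the circle, as a subtype of the circle. -/
noncomputable def rootsOfUnityEquivCircleSubtype (g : ℕ) :
    {ζ : Circle // ζ ^ g = 1} ≃ rootsOfUnity g Circle :=
  toUnits.toEquiv.subtypeEquiv fun ζ => by
    simp [mem_rootsOfUnity, Units.ext_iff]

theorem natCard_circle_pow_eq_one (g : ℕ) [NeZero g] :
    Nat.card {ζ : Circle // ζ ^ g = 1} = g := by
  rw [Nat.card_congr (rootsOfUnityEquivCircleSubtype g),
    HasEnoughRootsOfUnity.natCard_rootsOfUnity]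

theorem mem_torusKer_inf_coordSubtorus {n : ℕ} {c : Fin n → ℤ} {s : Finset (Fin n)}
    {t : Fin n → Circle} :
    t ∈ torusKer c ⊓ coordSubtorus (s : Set (Fin n)) ↔
      (∀ i ∉ s, t i = 1) ∧ ∏ i ∈ s, t i ^ c i = 1 := by
  have hmem : t ∈ torusKer c ⊓ coordSubtorus (s : Set (Fin n)) ↔
      ∏ i, t i ^ c i = 1 ∧ ∀ i ∉ s, t i = 1 := Iff.rfl
  rw [hmem, and_comm]
  refine and_congr_right fun ht => ?_
  rw [Finset.prod_subset s.subset_univ fun i _ hi => by rw [ht i hi, one_zpow]]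

theorem map_stabilizer_torusKer {n : ℕ} (c : Fin n → ℤ) (z : Fin n → ℂ) :
    (MulAction.stabilizer ↥(torusKer c) z).map (torusKer c).subtype
      = torusKer c ⊓ coordSubtorus {i | z i = 0} := by
  have hfix : ∀ t : Fin n → Circle, t • z = z ↔ t ∈ coordSubtorus {i | z i = 0} := by
    intro t
    rw [funext_iff]
    refine forall_congr' fun i => ?_
    change (t i : ℂ) * z i = z i ↔ (z i ≠ 0 → t i = 1)
    rw [mul_left_eq_self₀, Circle.coe_eq_one]
    tauto
  ext t
  constructor
  · rintro ⟨u, hu, rfl⟩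
    exact ⟨u.2, (hfix u).1 hu⟩
  · rintro ⟨htc, htz⟩
    exact ⟨⟨t, htc⟩, (hfix t).2 htz, rfl⟩

theorem connectedComponents_torusKer_inf_coordSubtorus {n : ℕ} (c : Fin n → ℤ)
    (s : Finset (Fin n)) (hs : ∃ i ∈ s, c i ≠ 0) :
    Finite (ConnectedComponents ↥(torusKer c ⊓ coordSubtorus (s : Set (Fin n)))) ∧
      Nat.card (ConnectedComponents ↥(torusKer c ⊓ coordSubtorus (s : Set (Fin n))))
        = s.gcd fun i => (c i).natAbs := by
  set H := torusKer c ⊓ coordSubtorus (s : Set (Fin n))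
  set g := s.gcd fun i => (c i).natAbs
  have hg0 : g ≠ 0 := by
    obtain ⟨i, hi, hci⟩ := hs
    exact Finset.gcd_ne_zero_iff.2 ⟨i, hi, Int.natAbs_ne_zero.2 hci⟩
  have : NeZero g := ⟨hg0⟩
  have hgc : (g : ℤ) = s.gcd c := Finset.natCast_gcd_natAbs s c
  obtain ⟨b, hb⟩ := Finset.gcd_eq_sum_mul s c
  let d : Fin n → ℤ := fun i => c i / g
  have hd : ∀ i ∈ s, c i = d i * g := fun i hi =>
    (Int.ediv_mul_cancel (hgc ▸ Finset.gcd_dvd hi)).symm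
  have hbd : ∑ i ∈ s, d i * b i = 1 := by
    refine mul_right_cancel₀ (Int.natCast_ne_zero.2 hg0) ?_
    calc (∑ i ∈ s, d i * b i) * (g : ℤ) = ∑ i ∈ s, c i * b i := by
          rw [Finset.sum_mul]
          exact Finset.sum_congr rfl fun i hi => by rw [hd i hi, mul_right_comm]
      _ = 1 * g := by rw [← hb, hgc, one_mul]
  have hpow : ∀ t : Fin n → Circle, ∏ i ∈ s, t i ^ c i = (∏ i ∈ s, t i ^ d i) ^ g := by
    intro t
    rw [← Finset.prod_pow]
    exact Finset.prod_congr rfl fun i hi => by rw [hd i hi, zpow_mul, zpow_natCast]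
  have hH : ∀ t, t ∈ H ↔ (∀ i ∉ s, t i = 1) ∧ (∏ i ∈ s, t i ^ d i) ^ g = 1 := fun t => by
    rw [← hpow]
    exact mem_torusKer_inf_coordSubtorus
  let f : H → {ζ : Circle // ζ ^ g = 1} := fun t =>
    ⟨∏ i ∈ s, (t : Fin n → Circle) i ^ d i, ((hH t).1 t.2).2⟩
  have hf : Continuous f := by
    refine Continuous.subtype_mk (continuous_finsetProd s fun i _ => ?_) _
    exact ((continuous_apply i).comp continuous_subtype_val).zpow (d i)
  have hfin : Finite {ζ : Circle // ζ ^ g = 1} :=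
    Nat.finite_of_card_ne_zero (by rwa [natCard_circle_pow_eq_one])
  have hsurj : Function.Surjective f := by
    rintro ⟨ζ, hζ⟩
    have hprod : ∏ i ∈ s, (if i ∈ s then ζ ^ b i else 1) ^ d i = ζ := by
      calc _ = ∏ i ∈ s, ζ ^ (d i * b i) := Finset.prod_congr rfl fun i hi => by
            rw [if_pos hi, ← zpow_mul, mul_comm]
        _ = ζ := by rw [← Finset.zpow_sum, hbd, zpow_one]
    exact ⟨⟨fun i => if i ∈ s then ζ ^ b i else 1,
      (hH _).2 ⟨fun i hi => if_neg hi, by rw [hprod, hζ]⟩⟩, Subtype.ext hprod⟩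
  have hfib : ∀ ζ, IsPreconnected (f ⁻¹' {ζ}) := by
    rintro ⟨ζ, hζ⟩
    rw [← Topology.IsInducing.subtypeVal.isPreconnected_image]
    convert isPreconnected_setOf_prod_zpow_eq s b d hbd ζ using 1
    ext t
    constructor
    · rintro ⟨u, hu, rfl⟩
      exact ⟨((hH u).1 u.2).1, congrArg Subtype.val hu⟩
    · rintro ⟨ht, htζ⟩
      exact ⟨⟨t, (hH t).2 ⟨ht, by rw [htζ, hζ]⟩⟩, Subtype.ext htζ, rfl⟩
  let e := Equiv.ofBijective _ (hf.connectedComponentsLift_bijective hsurj hfib)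
  exact ⟨Finite.of_equiv _ e.symm, by rw [Nat.card_congr e, natCard_circle_pow_eq_one]⟩

/-- for `z` with nonempty zero set `I = {i | z i = 0}`, the stabilizer of `z`
in `T'_c` is `T'_c ∩ G_I`, and its space of connected components is finite with exactly
`gcd_{i ∈ I} |c i|` elements. -/
theorem stabilizer_eq_inter_coordSubtorus_and_componentCount
    (n : ℕ) (c : Fin n → ℤ) (hc : ∀ i, c i ≠ 0)
    (z : Fin n → ℂ) (hz : ∃ i, z i = 0) :
    (MulAction.stabilizer ↥(torusKer c) z).map (torusKer c).subtype
        = torusKer c ⊓ coordSubtorus {i | z i = 0} ∧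
      Finite (ConnectedComponents ↥(torusKer c ⊓ coordSubtorus {i | z i = 0})) ∧
      Nat.card (ConnectedComponents ↥(torusKer c ⊓ coordSubtorus {i | z i = 0}))
        = (Finset.univ.filter fun i => z i = 0).gcd (fun i => (c i).natAbs) := by
  refine ⟨map_stabilizer_torusKer c z, ?_⟩
  have hcoe : {i | z i = 0} = ((Finset.univ.filter fun i => z i = 0 : Finset (Fin n)) :
      Set (Fin n)) := by
    simp
  obtain ⟨i, hi⟩ := hz
  rw [hcoe]
  exact connectedComponents_torusKer_inf_coordSubtorus c _ ⟨i, by simpa using hi, hc i⟩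
end

section
/- Let c : Fin n → ℤ with |c i| = 1 for every i, and let z ∈ ℂ^n have at most one zero coordinate (the set {i : z i = 0} has at most one element). Then the stabilizer of z in T'_c is the trivial subgroup. -/
open scoped BigOperators

theorem eq_one_of_smul_eq_self_of_ne_zero {n : ℕ} {t : Fin n → Circle} {z : Fin n → ℂ}
    (h : t • z = z) {i : Fin n} (hi : z i ≠ 0) : t i = 1 := by
  have h' : (t i : ℂ) * z i = z i := congrFun h i
  exact Circle.ext (by simpa using (mul_eq_right₀ hi).mp h')

theorem eq_one_of_torusChar_eq_one {n : ℕ} {c : Fin n → ℤ} {t : Fin n → Circle}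
    (h : torusChar c t = 1) {i : Fin n} (hc : (c i).natAbs = 1) (ht : ∀ j ≠ i, t j = 1) :
    t i = 1 := by
  have hprod : ∏ j, t j ^ c j = t i ^ c i :=
    Fintype.prod_eq_single i fun j hj => by rw [ht j hj, one_zpow]
  have hi : t i ^ c i = 1 := hprod.symm.trans h
  rcases Int.natAbs_eq_iff.mp hc with h1 | h1 <;> simpa [h1] using hi

/-- if all `|c i| = 1` and `z` has at most one zero coordinate, then the
stabilizer of `z` in `T'_c` is trivial. -/
theorem stabilizer_trivial_of_at_most_one_zero
    (n : ℕ) (c : Fin n → ℤ) (hc : ∀ i, (c i).natAbs = 1)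
    (z : Fin n → ℂ) (hz : {i | z i = 0}.Subsingleton) :
    MulAction.stabilizer ↥(torusKer c) z = ⊥ := by
  refine (Subgroup.eq_bot_iff_forall _).mpr fun ⟨t, ht⟩ hfix => Subtype.ext (funext fun i => ?_)
  have hsmul : t • z = z := hfix
  by_cases hi : z i = 0
  · exact eq_one_of_torusChar_eq_one ht (hc i) fun j hj =>
      eq_one_of_smul_eq_self_of_ne_zero hsmul fun hj0 => hj (hz hj0 hi)
  · exact eq_one_of_smul_eq_self_of_ne_zero hsmul hi
end

section
/- Let n ≥ 1 and let Q be the quotient topological space of the product {x : Fin n → ℝ | ∀ i, 0 ≤ x i} × Circle (the nonnegative quadrant with its subspace topology times the circle) by the equivalence relation generated by (x, s) ∼ (x, s') for all s, s' ∈ Circle whenever x i = 0 for some i. Then Q is homeomorphic to ℝ^{n+1} = (Fin (n+1) → ℝ). -/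
/-- The smallest coordinate of a real vector. -/
noncomputable def minCoord {k : ℕ} (x : Fin (k + 1) → ℝ) : ℝ :=
  Finset.univ.inf' Finset.univ_nonempty x

lemma minCoord_le {k : ℕ} (x : Fin (k + 1) → ℝ) (i : Fin (k + 1)) : minCoord x ≤ x i :=
  Finset.inf'_le _ (Finset.mem_univ i)

lemma exists_minCoord_eq {k : ℕ} (x : Fin (k + 1) → ℝ) : ∃ i, minCoord x = x i := by
  obtain ⟨i, -, hi⟩ := Finset.exists_mem_eq_inf' Finset.univ_nonempty x
  exact ⟨i, hi⟩

lemma minCoord_add_const {k : ℕ} (x : Fin (k + 1) → ℝ) (c : ℝ) :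
    minCoord (fun i => x i + c) = minCoord x + c := by
  obtain ⟨i, hi⟩ := exists_minCoord_eq x
  obtain ⟨j, hj⟩ := exists_minCoord_eq fun i => x i + c
  have h₁ := minCoord_le x j
  have h₂ := minCoord_le (fun i => x i + c) i
  linarith

lemma continuous_minCoord {k : ℕ} : Continuous (minCoord (k := k)) :=
  Continuous.finset_inf'_apply _ fun i _ => continuous_apply i

/-- The nonnegative quadrant is a closed half-space: a point is determined by the differences
with its first coordinate together with its smallest coordinate. -/
noncomputable def quadrantHomeomorph (k : ℕ) :
    {x : Fin (k + 1) → ℝ // ∀ i, 0 ≤ x i} ≃ₜ (Fin k → ℝ) × {r : ℝ // 0 ≤ r} where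
  toFun x := (fun i => x.1 i.succ - x.1 0, ⟨minCoord x.1, by
    obtain ⟨i, hi⟩ := exists_minCoord_eq x.1
    exact hi ▸ x.2 i⟩)
  invFun p := ⟨fun i => (Fin.cons 0 p.1 : Fin (k + 1) → ℝ) i +
      (p.2.1 - minCoord (Fin.cons 0 p.1 : Fin (k + 1) → ℝ)), fun i => by
    have h₁ := minCoord_le (Fin.cons 0 p.1 : Fin (k + 1) → ℝ) i
    have h₂ := p.2.2
    linarith⟩
  left_inv x := by
    have h : (Fin.cons 0 fun i => x.1 i.succ - x.1 0 : Fin (k + 1) → ℝ) =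
        fun i => x.1 i + -x.1 0 := by
      funext i
      refine Fin.cases ?_ (fun i => ?_) i
      · simp
      · simp [sub_eq_add_neg]
    ext i
    simp only [h, minCoord_add_const]
    ring
  right_inv p := by
    refine Prod.ext (funext fun i => ?_) (Subtype.ext ?_)
    · simp
    · simp only [minCoord_add_const]
      ring
  continuous_toFun := by
    refine Continuous.prodMk (continuous_pi fun i => ?_) ?_
    · exact ((continuous_apply i.succ).comp continuous_subtype_val).sub
        ((continuous_apply 0).comp continuous_subtype_val)
    · exact (continuous_minCoord.comp continuous_subtype_val).subtype_mk _
  continuous_invFun := by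
    have h : Continuous fun p : (Fin k → ℝ) × {r : ℝ // 0 ≤ r} =>
        (Fin.cons 0 p.1 : Fin (k + 1) → ℝ) := by
      refine continuous_pi fun i => ?_
      refine Fin.cases ?_ (fun i => ?_) i
      · simpa using continuous_const
      · simp only [Fin.cons_succ]
        fun_prop
    have h' := continuous_minCoord.comp h
    refine Continuous.subtype_mk (continuous_pi fun i => ?_) _
    exact ((continuous_apply i).comp h).add
      ((continuous_subtype_val.comp continuous_snd).sub h')

/-- Polar coordinates on the complex plane. -/
noncomputable def polarMap (p : {r : ℝ // 0 ≤ r} × Circle) : ℂ := (p.1.1 : ℂ) * (p.2 : ℂ)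

lemma norm_polarMap (p : {r : ℝ // 0 ≤ r} × Circle) : ‖polarMap p‖ = p.1.1 := by
  simp [polarMap, abs_of_nonneg p.1.2, Circle.norm_coe]

lemma polarMap_surjective : Function.Surjective polarMap := fun z =>
  ⟨(⟨‖z‖, norm_nonneg z⟩, Circle.exp z.arg), by simp [polarMap]⟩

lemma polarMap_eq_iff {p q : {r : ℝ // 0 ≤ r} × Circle} :
    polarMap p = polarMap q ↔ p.1 = q.1 ∧ (p.1.1 = 0 ∨ p.2 = q.2) := by
  constructor
  · intro h
    have h₁ : p.1 = q.1 := Subtype.ext (by rw [← norm_polarMap, h, norm_polarMap])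
    refine ⟨h₁, or_iff_not_imp_left.2 fun h₀ => Circle.ext ?_⟩
    rw [polarMap, polarMap, ← h₁] at h
    exact mul_left_cancel₀ (Complex.ofReal_ne_zero.2 h₀) h
  · rintro ⟨h₁, h₀ | h₂⟩
    · simp [polarMap, ← h₁, h₀]
    · simp [polarMap, h₁, h₂]

lemma isProperMap_polarMap : IsProperMap polarMap := by
  have hc : Continuous polarMap := by
    unfold polarMap
    fun_prop
  refine isProperMap_iff_isCompact_preimage.2 ⟨hc, fun K hK => ?_⟩
  have hsub : IsCompact (Subtype.val ⁻¹' ((fun z : ℂ => ‖z‖) '' K) : Set {r : ℝ // 0 ≤ r}) :=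
    (isClosed_Ici (a := (0 : ℝ))).isClosedEmbedding_subtypeVal.isCompact_preimage
      (hK.image continuous_norm)
  exact (hsub.prod isCompact_univ).of_isClosed_subset (hK.isClosed.preimage hc)
    fun p hp => ⟨⟨_, hp, norm_polarMap p⟩, Set.mem_univ _⟩

/-- The map collapsing the circles over the boundary of the quadrant. -/
noncomputable def quadrantCollapse (k : ℕ) (p : {x : Fin (k + 1) → ℝ // ∀ i, 0 ≤ x i} × Circle) :
    (Fin k → ℝ) × ℂ :=
  ((quadrantHomeomorph k p.1).1, polarMap ((quadrantHomeomorph k p.1).2, p.2))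

lemma isProperMap_quadrantCollapse (k : ℕ) : IsProperMap (quadrantCollapse k) :=
  (isProperMap_id.prodMap isProperMap_polarMap).comp
    (((quadrantHomeomorph k).prodCongr (Homeomorph.refl Circle)).trans
      (Homeomorph.prodAssoc _ _ _)).isProperMap

lemma quadrantCollapse_surjective (k : ℕ) : Function.Surjective (quadrantCollapse k) := by
  rintro ⟨d, z⟩
  obtain ⟨⟨r, s⟩, rfl⟩ := polarMap_surjective z
  exact ⟨((quadrantHomeomorph k).symm (d, r), s), by simp [quadrantCollapse]⟩

lemma quadrantHomeomorph_snd_eq_zero_iff {k : ℕ} (x : {x : Fin (k + 1) → ℝ // ∀ i, 0 ≤ x i}) :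
    (quadrantHomeomorph k x).2.1 = 0 ↔ ∃ i, x.1 i = 0 := by
  change minCoord x.1 = 0 ↔ _
  obtain ⟨j, hj⟩ := exists_minCoord_eq x.1
  constructor
  · exact fun h => ⟨j, hj ▸ h⟩
  · rintro ⟨i, hi⟩
    exact le_antisymm ((minCoord_le x.1 i).trans_eq hi) ((x.2 j).trans_eq hj.symm)

lemma quadrantCollapse_eq_iff {k : ℕ} {p q : {x : Fin (k + 1) → ℝ // ∀ i, 0 ≤ x i} × Circle} :
    quadrantCollapse k p = quadrantCollapse k q ↔
      p.1 = q.1 ∧ ((∃ i, p.1.1 i = 0) ∨ p.2 = q.2) := by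
  rw [← quadrantHomeomorph_snd_eq_zero_iff, ← (quadrantHomeomorph k).injective.eq_iff,
    quadrantCollapse, quadrantCollapse, Prod.ext_iff, Prod.ext_iff, polarMap_eq_iff, and_assoc]

/-- the quotient of `ℝ_{≥0}^n × S^1` collapsing the circle over every
boundary point of the quadrant is homeomorphic to `ℝ^{n+1}`. -/
theorem quadrant_times_circle_collapse_homeomorph_euclidean
    (n : ℕ) (hn : 1 ≤ n) :
    Nonempty (Quot (fun p q : {x : Fin n → ℝ // ∀ i, 0 ≤ x i} × Circle =>
        p.1 = q.1 ∧ ∃ i, (p.1 : Fin n → ℝ) i = 0) ≃ₜ (Fin (n + 1) → ℝ)) := by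
  obtain ⟨k, rfl⟩ := Nat.exists_eq_add_of_le' hn
  let r := fun p q : {x : Fin (k + 1) → ℝ // ∀ i, 0 ≤ x i} × Circle =>
    p.1 = q.1 ∧ ∃ i, (p.1 : Fin (k + 1) → ℝ) i = 0
  have hr : ∀ p q, r p q → quadrantCollapse k p = quadrantCollapse k q :=
    fun p q h => quadrantCollapse_eq_iff.2 ⟨h.1, Or.inl h.2⟩
  have hproper := isProperMap_quadrantCollapse k
  have hhomeo : IsHomeomorph (Quot.lift (quadrantCollapse k) hr) := by
    refine isHomeomorph_iff_continuous_isClosedMap_bijective.2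
      ⟨continuous_quot_lift hr hproper.continuous, ?_, ?_, ?_⟩
    · exact IsClosedMap.of_comp_surjective (f := Quot.mk r) Quot.mk_surjective
        continuous_quot_mk hproper.isClosedMap
    · rintro ⟨p⟩ ⟨q⟩ h
      obtain ⟨h₁, h₀ | h₂⟩ := quadrantCollapse_eq_iff.1 h
      · exact Quot.sound ⟨h₁, h₀⟩
      · exact congrArg (Quot.mk r) (Prod.ext h₁ h₂)
    · exact Quot.surjective_lift hr |>.2 (quadrantCollapse_surjective k)
  have hrank : Module.finrank ℝ ((Fin k → ℝ) × ℂ) = Module.finrank ℝ (Fin (k + 1 + 1) → ℝ) := by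
    simp [Complex.finrank_real_complex]
  exact ⟨hhomeo.homeomorph.trans (ContinuousLinearEquiv.ofFinrankEq hrank).toHomeomorph⟩
end

section
/- Let n ≥ 1 and let Q be the quotient topological space of (closed unit ball of the Euclidean space ℝ^n) × Circle by the equivalence relation generated by (x, s) ∼ (x, s') for all s, s' ∈ Circle whenever ‖x‖ = 1. Then Q is homeomorphic to the unit sphere S^{n+1}, i.e., to {y ∈ ℝ^{n+2} : ‖y‖ = 1} with its subspace topology. -/
open Metric

/-- The map `(x, s) ↦ (x, √(1 - ‖x‖²) s)` from `D^n × S^1` to `ℝ^{n+2}`. -/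
noncomputable def ballCircleJoin (n : ℕ)
    (p : closedBall (0 : EuclideanSpace ℝ (Fin n)) 1 × Circle) : EuclideanSpace ℝ (Fin (n + 2)) :=
  WithLp.toLp 2 (Fin.append (p.1 : EuclideanSpace ℝ (Fin n))
    ![√(1 - ‖(p.1 : EuclideanSpace ℝ (Fin n))‖ ^ 2) * (p.2 : ℂ).re,
      √(1 - ‖(p.1 : EuclideanSpace ℝ (Fin n))‖ ^ 2) * (p.2 : ℂ).im])

theorem ballCircleJoin_castAdd {n : ℕ} (p : closedBall (0 : EuclideanSpace ℝ (Fin n)) 1 × Circle)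
    (i : Fin n) :
    ballCircleJoin n p (Fin.castAdd 2 i) = (p.1 : EuclideanSpace ℝ (Fin n)) i := by
  simp [ballCircleJoin]

theorem ballCircleJoin_natAdd_zero {n : ℕ}
    (p : closedBall (0 : EuclideanSpace ℝ (Fin n)) 1 × Circle) :
    ballCircleJoin n p (Fin.natAdd n 0) =
      √(1 - ‖(p.1 : EuclideanSpace ℝ (Fin n))‖ ^ 2) * (p.2 : ℂ).re := by
  simp only [ballCircleJoin, Fin.append_right, Matrix.cons_val_zero]

theorem ballCircleJoin_natAdd_one {n : ℕ}
    (p : closedBall (0 : EuclideanSpace ℝ (Fin n)) 1 × Circle) :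
    ballCircleJoin n p (Fin.natAdd n 1) =
      √(1 - ‖(p.1 : EuclideanSpace ℝ (Fin n))‖ ^ 2) * (p.2 : ℂ).im := by
  simp only [ballCircleJoin, Fin.append_right, Matrix.cons_val_one, Matrix.cons_val_fin_one]

theorem continuous_ballCircleJoin (n : ℕ) : Continuous (ballCircleJoin n) := by
  refine (PiLp.continuous_toLp 2 _).comp (continuous_pi fun i => ?_)
  refine Fin.addCases (fun i => ?_) (fun i => ?_) i
  · simp only [Fin.append_left]
    fun_prop
  · simp only [Fin.append_right]
    have hs : Continuous fun p : closedBall (0 : EuclideanSpace ℝ (Fin n)) 1 × Circle =>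
        (p.2 : ℂ) := continuous_subtype_val.comp continuous_snd
    fin_cases i
    · exact Continuous.mul (by fun_prop) (Complex.continuous_re.comp hs)
    · exact Continuous.mul (by fun_prop) (Complex.continuous_im.comp hs)

theorem EuclideanSpace.norm_sq_eq_castAdd_add (n : ℕ) (y : EuclideanSpace ℝ (Fin (n + 2))) :
    ‖y‖ ^ 2 = ‖WithLp.toLp 2 fun i : Fin n => y (Fin.castAdd 2 i)‖ ^ 2 +
      (y (Fin.natAdd n 0) ^ 2 + y (Fin.natAdd n 1) ^ 2) := by
  simp only [EuclideanSpace.real_norm_sq_eq, Fin.sum_univ_add, Fin.sum_univ_two]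

theorem one_sub_norm_sq_nonneg {n : ℕ} (x : closedBall (0 : EuclideanSpace ℝ (Fin n)) 1) :
    0 ≤ 1 - ‖(x : EuclideanSpace ℝ (Fin n))‖ ^ 2 := by
  have h := mem_closedBall_zero_iff.1 x.2
  nlinarith [norm_nonneg (x : EuclideanSpace ℝ (Fin n))]

theorem ballCircleJoin_mem_sphere {n : ℕ}
    (p : closedBall (0 : EuclideanSpace ℝ (Fin n)) 1 × Circle) :
    ballCircleJoin n p ∈ sphere (0 : EuclideanSpace ℝ (Fin (n + 2))) 1 := by
  rw [mem_sphere_zero_iff_norm, ← sq_eq_sq₀ (norm_nonneg _) zero_le_one,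
    EuclideanSpace.norm_sq_eq_castAdd_add, ballCircleJoin_natAdd_zero, ballCircleJoin_natAdd_one]
  simp only [ballCircleJoin_castAdd, WithLp.toLp_ofLp]
  have h := Real.sq_sqrt (one_sub_norm_sq_nonneg p.1)
  have hs : (p.2 : ℂ).re * (p.2 : ℂ).re + (p.2 : ℂ).im * (p.2 : ℂ).im = 1 := by
    rw [← Complex.normSq_apply, Circle.normSq_coe]
  linear_combination h + √(1 - ‖(p.1 : EuclideanSpace ℝ (Fin n))‖ ^ 2) ^ 2 * hs

theorem ballCircleJoin_eq_iff {n : ℕ}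
    (p q : closedBall (0 : EuclideanSpace ℝ (Fin n)) 1 × Circle) :
    ballCircleJoin n p = ballCircleJoin n q ↔
      p = q ∨ p.1 = q.1 ∧ ‖(p.1 : EuclideanSpace ℝ (Fin n))‖ = 1 := by
  constructor
  · intro h
    have hx : p.1 = q.1 := by
      ext i
      rw [← ballCircleJoin_castAdd, h, ballCircleJoin_castAdd]
    by_cases hp : ‖(p.1 : EuclideanSpace ℝ (Fin n))‖ = 1
    · exact Or.inr ⟨hx, hp⟩
    have hr : √(1 - ‖(p.1 : EuclideanSpace ℝ (Fin n))‖ ^ 2) ≠ 0 := by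
      rw [Real.sqrt_ne_zero (one_sub_norm_sq_nonneg _), sub_ne_zero, ne_comm, Ne,
        pow_eq_one_iff_of_nonneg (norm_nonneg _) two_ne_zero]
      exact hp
    refine Or.inl (Prod.ext hx (Circle.ext (Complex.ext (mul_left_cancel₀ hr ?_)
      (mul_left_cancel₀ hr ?_))))
    · rw [← ballCircleJoin_natAdd_zero, h, ballCircleJoin_natAdd_zero, hx]
    · rw [← ballCircleJoin_natAdd_one, h, ballCircleJoin_natAdd_one, hx]
  · rintro (rfl | ⟨hx, hp⟩)
    · rfl
    · simp [ballCircleJoin, ← hx, hp]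

theorem exists_ballCircleJoin_eq {n : ℕ} {y : EuclideanSpace ℝ (Fin (n + 2))}
    (hy : y ∈ sphere (0 : EuclideanSpace ℝ (Fin (n + 2))) 1) :
    ∃ p, ballCircleJoin n p = y := by
  have hsum := EuclideanSpace.norm_sq_eq_castAdd_add n y
  rw [mem_sphere_zero_iff_norm.1 hy] at hsum
  set x : EuclideanSpace ℝ (Fin n) := WithLp.toLp 2 fun i => y (Fin.castAdd 2 i)
  set z : ℂ := ⟨y (Fin.natAdd n 0), y (Fin.natAdd n 1)⟩
  have hx : x ∈ closedBall (0 : EuclideanSpace ℝ (Fin n)) 1 := by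
    rw [mem_closedBall_zero_iff, ← sq_le_one_iff₀ (norm_nonneg _)]
    nlinarith [sq_nonneg (y (Fin.natAdd n 0)), sq_nonneg (y (Fin.natAdd n 1))]
  have hr : √(1 - ‖x‖ ^ 2) = ‖z‖ := by
    rw [Complex.norm_def, Complex.normSq_apply]
    congr 1
    linear_combination hsum
  have hpolar : (‖z‖ : ℂ) * (Circle.exp z.arg : ℂ) = z := by
    rw [Circle.coe_exp, Complex.norm_mul_exp_arg_mul_I]
  refine ⟨(⟨x, hx⟩, Circle.exp z.arg), PiLp.ext fun i => ?_⟩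
  refine Fin.addCases (fun i => ?_) (fun i => ?_) i
  · exact ballCircleJoin_castAdd _ i
  · fin_cases i
    · refine (ballCircleJoin_natAdd_zero _).trans ?_
      rw [hr, ← Complex.re_ofReal_mul, hpolar]
      rfl
    · refine (ballCircleJoin_natAdd_one _).trans ?_
      rw [hr, ← Complex.im_ofReal_mul, hpolar]
      rfl

/-- `D^n × S^1` with the circles over boundary points of the disc collapsed
is homeomorphic to the sphere `S^{n+1} ⊆ ℝ^{n+2}`. -/
theorem ball_times_circle_collapse_homeomorph_sphere
    (n : ℕ) (hn : 1 ≤ n) :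
    Nonempty (Quot (fun p q : (Metric.closedBall (0 : EuclideanSpace ℝ (Fin n)) 1) × Circle =>
        p.1 = q.1 ∧ ‖(p.1 : EuclideanSpace ℝ (Fin n))‖ = 1)
      ≃ₜ (Metric.sphere (0 : EuclideanSpace ℝ (Fin (n + 2))) 1)) := by
  let g : closedBall (0 : EuclideanSpace ℝ (Fin n)) 1 × Circle →
      sphere (0 : EuclideanSpace ℝ (Fin (n + 2))) 1 :=
    fun p => ⟨ballCircleJoin n p, ballCircleJoin_mem_sphere p⟩
  have hg : Continuous g := (continuous_ballCircleJoin n).subtype_mk _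
  let f := Quot.lift (r := fun p q : closedBall (0 : EuclideanSpace ℝ (Fin n)) 1 × Circle =>
    p.1 = q.1 ∧ ‖(p.1 : EuclideanSpace ℝ (Fin n))‖ = 1) g
    fun p q h => Subtype.ext ((ballCircleJoin_eq_iff p q).2 (Or.inr h))
  have hf : Continuous f := continuous_quot_lift _ hg
  have hbij : Function.Bijective f := by
    constructor
    · rintro ⟨p⟩ ⟨q⟩ h
      rcases (ballCircleJoin_eq_iff p q).1 (congrArg Subtype.val h) with rfl | h
      · rfl
      · exact Quot.sound h
    · rintro ⟨y, hy⟩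
      obtain ⟨p, hp⟩ := exists_ballCircleJoin_eq hy
      exact ⟨Quot.mk _ p, Subtype.ext hp⟩
  exact ⟨hf.homeoOfEquivCompactToT2 (f := Equiv.ofBijective f hbij)⟩
end

section
/- Let n ≥ 2, let α : Fin n → (Fin (n-1) → ℤ) be integer vectors whose images in ℚ^{n-1} span ℚ^{n-1}, and let c : Fin n → ℤ satisfy gcd_i |c i| = 1 and ∑ i, (c i) • (α i) = 0 in Fin (n-1) → ℤ. Let φ : T^{n-1} → T^n be the continuous group homomorphism defined by (φ t) i = ∏ j, (t j)^(α i j). Then the range of φ equals the kernel T'_c of the character χ_c. -/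
open scoped BigOperators

open Matrix in
/-- A matrix of corank one whose columns are annihilated by `c ≠ 0` has image the hyperplane
`c ⬝ᵥ v = 0`. -/
theorem exists_mulVec_eq_of_leftInverse {K ι κ : Type*} [Field K] [Fintype ι] [Fintype κ]
    [DecidableEq κ] (hcard : Fintype.card κ + 1 = Fintype.card ι)
    {A : Matrix ι κ K} {B : Matrix κ ι K} (hBA : B * A = 1)
    {c : ι → K} (hc : c ≠ 0) (hcA : c ᵥ* A = 0) {v : ι → K} (hv : c ⬝ᵥ v = 0) :
    ∃ x, A *ᵥ x = v := by
  classical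
  have hinj : Function.Injective A.mulVecLin := fun x y hxy => by
    simpa [hBA] using congrArg (B *ᵥ ·) hxy
  let f : Module.Dual K (ι → K) := dotProductBilin K K c
  have hf : f ≠ 0 := fun h => hc <| funext fun i => by
    simpa [f] using LinearMap.congr_fun h (Pi.single i 1)
  have hle : LinearMap.range A.mulVecLin ≤ LinearMap.ker f := by
    rintro _ ⟨x, rfl⟩
    simp [f, dotProduct_mulVec, hcA]
  have hrange := LinearMap.finrank_range_of_inj hinj
  have hker := Module.Dual.finrank_ker_add_one_of_ne_zero hf
  rw [Module.finrank_fintype_fun_eq_card] at hrange hker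
  have heq := Submodule.eq_of_le_of_finrank_eq hle (by omega)
  have hvker : v ∈ LinearMap.ker f := by simpa [f] using hv
  rw [← heq] at hvker
  exact hvker

theorem exists_leftInverse_of_span_rows_eq_top {K ι κ : Type*} [Field K] [Fintype ι]
    [Fintype κ] [DecidableEq κ] {A : Matrix ι κ K}
    (h : Submodule.span K (Set.range A) = ⊤) : ∃ B : Matrix κ ι K, B * A = 1 := by
  have hmem (j : κ) : ∃ b : ι → K, ∑ i, b i • A i = (1 : Matrix κ κ K) j :=
    (Submodule.mem_span_range_iff_exists_fun K).1 (h ▸ Submodule.mem_top)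
  choose B hB using hmem
  refine ⟨Matrix.of B, Matrix.ext fun j k => ?_⟩
  simpa [Matrix.mul_apply] using congrFun (hB j) k

theorem exists_sum_mul_eq_one_of_gcd_natAbs {ι : Type*} {s : Finset ι} {c : ι → ℤ}
    (h : s.gcd (fun i => (c i).natAbs) = 1) : ∃ m : ι → ℤ, ∑ i ∈ s, c i * m i = 1 := by
  obtain ⟨m, hm⟩ := s.gcd_eq_sum_mul c
  have hdvd : (s.gcd c).natAbs ∣ 1 := h ▸ Finset.dvd_gcd fun i hi =>
    Int.natAbs_dvd_natAbs.2 (Finset.gcd_dvd hi)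
  refine ⟨m, ?_⟩
  rw [← hm, ← Finset.normalize_gcd, normalize_eq_one, Int.isUnit_iff_natAbs_eq]
  exact Nat.dvd_one.1 hdvd

theorem zpow_finsetSum {G ι : Type*} [CommGroup G] (g : G) (s : Finset ι) (f : ι → ℤ) :
    g ^ ∑ i ∈ s, f i = ∏ i ∈ s, g ^ f i :=
  map_sum (zmultiplesHom (Additive G) (Additive.ofMul g)) f s

theorem torusChar_weightHom {n : ℕ} {α : Fin n → Fin (n - 1) → ℤ} {c : Fin n → ℤ}
    (hrel : ∑ i, c i • α i = 0) (t : Fin (n - 1) → Circle) :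
    torusChar c (weightHom α t) = 1 := by
  change ∏ i, (∏ j, t j ^ α i j) ^ c i = 1
  simp_rw [← Finset.prod_zpow, ← zpow_mul]
  rw [Finset.prod_comm]
  refine Finset.prod_eq_one fun j _ => ?_
  rw [← zpow_finsetSum]
  have : ∑ i, α i j * c i = 0 := by simpa [mul_comm] using congrFun hrel j
  rw [this, zpow_zero]

/-- Points of the kernel of a primitive character lift to the hyperplane `∑ i, c i * θ i = 0`. -/
theorem exists_exp_eq_of_mem_torusKer {n : ℕ} {c m : Fin n → ℤ} (hm : ∑ i, c i * m i = 1)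
    {s : Fin n → Circle} (hs : s ∈ torusKer c) :
    ∃ θ : Fin n → ℝ, (∀ i, Circle.exp (θ i) = s i) ∧ ∑ i, (c i : ℝ) * θ i = 0 := by
  choose θ hθ using fun i => Circle.exp_surjective (s i)
  have hexp : Circle.exp (∑ i, (c i : ℝ) * θ i) = 1 := by
    rw [Circle.exp_sum]
    simp_rw [Circle.exp_intCast_mul, hθ]
    exact hs
  obtain ⟨k, hk⟩ := Circle.exp_eq_one.1 hexp
  refine ⟨fun i => θ i - (k * m i : ℤ) * (2 * Real.pi), fun i => ?_, ?_⟩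
  · rw [Circle.exp_sub, Circle.exp_int_mul_two_pi, div_one, hθ]
  · have hm' : ∑ i, (c i : ℝ) * m i = 1 := by exact_mod_cast hm
    calc ∑ i, (c i : ℝ) * (θ i - (k * m i : ℤ) * (2 * Real.pi))
        = ∑ i, (c i : ℝ) * θ i - (∑ i, (c i : ℝ) * m i) * (k * (2 * Real.pi)) := by
          rw [Finset.sum_mul, ← Finset.sum_sub_distrib]
          refine Finset.sum_congr rfl fun i _ => ?_
          push_cast
          ring
      _ = 0 := by rw [hk, hm', one_mul, sub_self]

/-- if the weights `α i` span `ℚ^{n-1}` and `c` is a primitive integer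
relation on them, then the image of `φ : T^{n-1} → T^n` equals `T'_c = ker χ_c`. -/
theorem range_weightHom_eq_torusKer
    (n : ℕ) (hn : 2 ≤ n) (α : Fin n → Fin (n - 1) → ℤ)
    (hspan : Submodule.span ℚ (Set.range fun i => fun j => ((α i j : ℚ))) = ⊤)
    (c : Fin n → ℤ)
    (hgcd : Finset.univ.gcd (fun i => (c i).natAbs) = 1)
    (hrel : ∑ i, c i • α i = 0) :
    (weightHom α).range = torusKer c := by
  apply le_antisymm
  · rintro _ ⟨t, rfl⟩
    exact torusChar_weightHom hrel t
  intro s hs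
  obtain ⟨m, hm⟩ := exists_sum_mul_eq_one_of_gcd_natAbs hgcd
  obtain ⟨θ, hθ, hcθ⟩ := exists_exp_eq_of_mem_torusKer hm hs
  obtain ⟨B, hB⟩ := exists_leftInverse_of_span_rows_eq_top
    (A := Matrix.of fun i j => (α i j : ℚ)) hspan
  have hBA : B.map (Rat.castHom ℝ) * Matrix.of (fun i j => (α i j : ℝ)) = 1 := by
    have h := congrArg (fun M => M.map (Rat.castHom ℝ)) hB
    simp only [Matrix.map_mul, Matrix.map_one _ (map_zero (Rat.castHom ℝ)) (map_one _)] at h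
    rw [← h]
    congr 1
  have hc : (fun i => (c i : ℝ)) ≠ 0 := fun h => by
    have hc0 (i : Fin n) : c i = 0 := by simpa using congrFun h i
    simp [hc0] at hm
  obtain ⟨x, hx⟩ := exists_mulVec_eq_of_leftInverse (by simp; omega) hBA hc
    (by
      ext j
      have := congrFun hrel j
      simp only [Finset.sum_apply, Pi.smul_apply, smul_eq_mul, Pi.zero_apply] at this
      simp only [Matrix.vecMul, dotProduct, Matrix.of_apply, Pi.zero_apply]
      exact_mod_cast this) (v := θ) hcθ
  refine ⟨fun j => Circle.exp (x j), funext fun i => ?_⟩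
  rw [← hθ i, ← hx]
  change ∏ j, Circle.exp (x j) ^ α i j = Circle.exp (∑ j, (α i j : ℝ) * x j)
  simp_rw [Circle.exp_sum, Circle.exp_intCast_mul]
end

section
/- Let n ≥ 2, let v : Fin (n-1) → (Fin (n-1) → ℝ) be a basis of ℝ^{n-1}, and set v_n = -(∑ i, v i). Let C ⊆ ℝ^{n-1} be the union, over all subsets I of the n vectors {v_1, …, v_{n-1}, v_n} with |I| = n-2, of the cones {∑_{i ∈ I} t_i v_i : t_i ≥ 0 for all i ∈ I}. Then C, with its subspace topology from ℝ^{n-1}, is homeomorphic to the (n-2)-skeleton {x : Fin n → ℝ | (∀ i, 0 ≤ x i) and x i = 0 for at least two indices i} of the nonnegative cone ℝ_{≥0}^n, with its subspace topology from Fin n → ℝ. -/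
open scoped BigOperators

/-- The linear combination of `v 0, …, v (m - 1), -∑ k, v k` with coefficients `y`. -/
def fanCombination {m : ℕ} (v : Fin m → Fin m → ℝ) (y : Fin (m + 1) → ℝ) : Fin m → ℝ :=
  ∑ i, y i • (Fin.snoc v (-(∑ k, v k)) : Fin (m + 1) → Fin m → ℝ) i

/-- The translate of a real vector by a constant vector whose smallest coordinate is zero. -/
def subMinCoord {m : ℕ} (c : Fin (m + 1) → ℝ) : Fin (m + 1) → ℝ :=
  fun i => c i - Finset.univ.inf' Finset.univ_nonempty c

/-- The coordinates with respect to the basis `b`, extended by a last coordinate zero and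
translated by a constant vector so that the smallest coordinate is zero. -/
noncomputable def fanCoords {m : ℕ} (b : Module.Basis (Fin m) ℝ (Fin m → ℝ)) (x : Fin m → ℝ) :
    Fin (m + 1) → ℝ :=
  subMinCoord (Fin.snoc (b.equivFun x) 0 : Fin (m + 1) → ℝ)

theorem fanCombination_eq {m : ℕ} (v : Fin m → Fin m → ℝ) (y : Fin (m + 1) → ℝ) :
    fanCombination v y = ∑ i : Fin m, (y i.castSucc - y (Fin.last m)) • v i := by
  simp only [fanCombination, Fin.sum_univ_castSucc, Fin.snoc_castSucc, Fin.snoc_last, add_smul,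
    neg_smul, smul_neg, Finset.smul_sum, sub_eq_add_neg, Finset.sum_add_distrib,
    Finset.sum_neg_distrib]

theorem continuous_fanCombination {m : ℕ} (v : Fin m → Fin m → ℝ) :
    Continuous (fanCombination v) := by
  unfold fanCombination
  fun_prop

theorem continuous_subMinCoord {m : ℕ} : Continuous (subMinCoord (m := m)) :=
  continuous_pi fun i => (continuous_apply i).sub
    (Continuous.finset_inf'_apply _ fun j _ => continuous_apply j)

theorem continuous_fanCoords {m : ℕ} (b : Module.Basis (Fin m) ℝ (Fin m → ℝ)) :
    Continuous (fanCoords b) := by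
  have hb : Continuous b.equivFun := b.equivFun.toLinearMap.continuous_of_finiteDimensional
  exact continuous_subMinCoord.comp (hb.finSnoc continuous_const)

theorem subMinCoord_sub_const {m : ℕ} {y : Fin (m + 1) → ℝ} (hy : ∀ i, 0 ≤ y i)
    {j : Fin (m + 1)} (hj : y j = 0) (a : ℝ) : subMinCoord (fun i => y i - a) = y := by
  have h : Finset.univ.inf' Finset.univ_nonempty (fun i => y i - a) = -a := by
    refine le_antisymm ?_ (Finset.le_inf' _ _ fun i _ => by linarith [hy i])
    exact (Finset.inf'_le (fun i => y i - a) (Finset.mem_univ j)).trans_eq (by rw [hj, zero_sub])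
  funext i
  simp only [subMinCoord, h]
  ring

theorem fanCombination_fanCoords {m : ℕ} (b : Module.Basis (Fin m) ℝ (Fin m → ℝ))
    (x : Fin m → ℝ) : fanCombination b (fanCoords b x) = x := by
  rw [fanCombination_eq]
  simp [fanCoords, subMinCoord, b.sum_repr]

theorem fanCoords_fanCombination {m : ℕ} (b : Module.Basis (Fin m) ℝ (Fin m → ℝ))
    {y : Fin (m + 1) → ℝ} (hy : ∀ i, 0 ≤ y i) {j : Fin (m + 1)} (hj : y j = 0) :
    fanCoords b (fanCombination b y) = y := by
  have h : (Fin.snoc (b.equivFun (fanCombination b y)) 0 : Fin (m + 1) → ℝ) =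
      fun i => y i - y (Fin.last m) := by
    rw [fanCombination_eq, ← b.equivFun_symm_apply, LinearEquiv.apply_symm_apply]
    funext i
    refine Fin.lastCases ?_ (fun k => ?_) i <;> simp
  rw [fanCoords, h, subMinCoord_sub_const hy hj]

/-- The union of the cones spanned by `m - 1` of the vectors `v 0, …, v (m - 1), -∑ k, v k`
consists of their nonnegative combinations with at least two vanishing coefficients. -/
theorem exists_cone_iff_exists_fanCombination {m : ℕ} (hm : 1 ≤ m) (v : Fin m → Fin m → ℝ)
    (x : Fin m → ℝ) :
    (∃ I : Finset (Fin (m + 1)), I.card = m - 1 ∧ ∃ t : Fin (m + 1) → ℝ,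
        (∀ i ∈ I, 0 ≤ t i) ∧ x = ∑ i ∈ I, t i • Fin.snoc v (-(∑ k, v k)) i) ↔
      ∃ y : Fin (m + 1) → ℝ, ((∀ i, 0 ≤ y i) ∧ ∃ i j, i ≠ j ∧ y i = 0 ∧ y j = 0) ∧
        fanCombination v y = x := by
  constructor
  · rintro ⟨I, hI, t, ht, rfl⟩
    have hc : 1 < Iᶜ.card := by
      rw [Finset.card_compl, Fintype.card_fin]
      omega
    obtain ⟨i, hi, j, hj, hij⟩ := Finset.one_lt_card.mp hc
    rw [Finset.mem_compl] at hi hj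
    refine ⟨fun k => if k ∈ I then t k else 0, ⟨fun k => ?_, i, j, hij, if_neg hi, if_neg hj⟩, ?_⟩
    · dsimp only
      split_ifs with hk
      exacts [ht k hk, le_rfl]
    · simp [fanCombination, ite_smul, Finset.sum_ite_mem]
  · rintro ⟨y, ⟨hy, i, j, hij, hi, hj⟩, rfl⟩
    refine ⟨{i, j}ᶜ, ?_, y, fun k _ => hy k, ?_⟩
    · rw [Finset.card_compl, Finset.card_pair hij, Fintype.card_fin]
      omega
    · refine (Finset.sum_subset (Finset.subset_univ _) fun k _ hk => ?_).symm
      rw [Finset.mem_compl, not_not, Finset.mem_insert, Finset.mem_singleton] at hk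
      rcases hk with rfl | rfl <;> simp [hi, hj]

/-- for a basis `v_1, …, v_m` of `ℝ^m` (`m = n - 1 ≥ 1`) and
`v_{m+1} = -(v_1 + ⋯ + v_m)`, the union `C` of the cones spanned by the subfamilies of
`n - 2 = m - 1` of the vectors is homeomorphic to the `(n-2)`-skeleton of the nonnegative
cone `ℝ_{≥0}^n`, i.e. the set of nonnegative vectors with at least two vanishing
coordinates. -/
theorem skeleton_of_A_fan_homeomorph_skeleton_of_quadrant
    (m : ℕ) (hm : 1 ≤ m) (v : Fin m → Fin m → ℝ)
    (hind : LinearIndependent ℝ v)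
    (hspan : Submodule.span ℝ (Set.range v) = ⊤) :
    Nonempty (
      ({x : Fin m → ℝ | ∃ I : Finset (Fin (m + 1)), I.card = m - 1 ∧
          ∃ t : Fin (m + 1) → ℝ, (∀ i ∈ I, 0 ≤ t i) ∧
            x = ∑ i ∈ I, t i • Fin.snoc v (-(∑ k, v k)) i} : Set (Fin m → ℝ)) ≃ₜ
      ({x : Fin (m + 1) → ℝ | (∀ i, 0 ≤ x i) ∧
          ∃ i j : Fin (m + 1), i ≠ j ∧ x i = 0 ∧ x j = 0} : Set (Fin (m + 1) → ℝ))) := by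
  obtain ⟨b, rfl⟩ : ∃ b : Module.Basis (Fin m) ℝ (Fin m → ℝ), ⇑b = v :=
    ⟨Module.Basis.mk hind hspan.ge, Module.Basis.coe_mk _ _⟩
  have hmem : ∀ x : Fin m → ℝ, (∃ I : Finset (Fin (m + 1)), I.card = m - 1 ∧
      ∃ t : Fin (m + 1) → ℝ, (∀ i ∈ I, 0 ≤ t i) ∧
        x = ∑ i ∈ I, t i • Fin.snoc b (-(∑ k, b k)) i) →
      (∀ i, 0 ≤ fanCoords b x i) ∧
        ∃ i j, i ≠ j ∧ fanCoords b x i = 0 ∧ fanCoords b x j = 0 := by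
    intro x h
    obtain ⟨y, hy, rfl⟩ := (exists_cone_iff_exists_fanCombination hm b x).mp h
    obtain ⟨i, -, -, hi, -⟩ := hy.2
    rwa [fanCoords_fanCombination b hy.1 hi]
  exact ⟨{
    toFun := fun x => ⟨fanCoords b x, hmem x x.2⟩
    invFun := fun y => ⟨fanCombination b y,
      (exists_cone_iff_exists_fanCombination hm b _).mpr ⟨y, y.2, rfl⟩⟩
    left_inv := fun x => Subtype.ext (fanCombination_fanCoords b x)
    right_inv := fun y => by
      obtain ⟨i, -, -, hi, -⟩ := y.2.2
      exact Subtype.ext (fanCoords_fanCombination b y.2.1 hi)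
    continuous_toFun := Continuous.subtype_mk
      ((continuous_fanCoords b).comp continuous_subtype_val) fun x => hmem x x.2
    continuous_invFun := Continuous.subtype_mk
      ((continuous_fanCombination b).comp continuous_subtype_val) fun y =>
        (exists_cone_iff_exists_fanCombination hm b _).mpr ⟨y, y.2, rfl⟩ }⟩
end

section
/- Let a, v : Fin n → ℤ with gcd_i |v i| = 1 (v is primitive) and ⟨a, v⟩ = ∑ i, (a i) * (v i) ≠ 0. Let S_v ⊆ T^n be the range of the continuous group homomorphism Circle → T^n sending s to the tuple (s^(v i))_i. Then the intersection of the subgroups S_v and T'_a (the kernel of χ_a) is a finite cyclic group of order |⟨a, v⟩|. In particular, S_v ∩ T'_a is trivial if and only if ⟨a, v⟩ = 1 or ⟨a, v⟩ = -1. -/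
open scoped BigOperators

/-- The cocharacter homomorphism `Circle → T^n`, `s ↦ (s^(v i))_i`. -/
noncomputable def cocharHom {n : ℕ} (v : Fin n → ℤ) : Circle →* (Fin n → Circle) where
  toFun s := fun i => s ^ v i
  map_one' := by funext i; simp
  map_mul' a b := by funext i; exact mul_zpow a b (v i)

theorem cocharHom_injective {n : ℕ} {v : Fin n → ℤ}
    (hv : Finset.univ.gcd (fun i => (v i).natAbs) = 1) :
    Function.Injective (cocharHom v) := by
  rw [injective_iff_map_eq_one]
  intro s hs
  have h : orderOf s ∣ Finset.univ.gcd (fun i => (v i).natAbs) :=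
    Finset.dvd_gcd fun i _ =>
      Int.natCast_dvd.mp (orderOf_dvd_iff_zpow_eq_one.mpr (congrFun hs i))
  rwa [hv, Nat.dvd_one, orderOf_eq_one_iff] at h

theorem torusChar_cocharHom {n : ℕ} (a v : Fin n → ℤ) (s : Circle) :
    torusChar a (cocharHom v s) = s ^ ∑ i, a i * v i := by
  change ∏ i, (s ^ v i) ^ a i = _
  simp_rw [← zpow_mul, mul_comm (v _)]
  exact (map_sum (zpowersHom Circle s).toAdditiveRight _ _).symm

/-- The cocharacter circle meets `ker χ_a` in the image of the `|⟨a, v⟩|`-th roots of unity. -/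
theorem cocharHom_range_inf_torusKer {n : ℕ} (a v : Fin n → ℤ) :
    (cocharHom v).range ⊓ torusKer a =
      (rootsOfUnity (∑ i, a i * v i).natAbs Circle).map
        ((cocharHom v).comp (toUnits (G := Circle)).symm.toMonoidHom) := by
  ext t
  constructor
  · rintro ⟨⟨s, rfl⟩, hs⟩
    have hs : s ^ ∑ i, a i * v i = 1 := (torusChar_cocharHom a v s).symm.trans hs
    refine ⟨toUnits s, ?_, rfl⟩
    rw [SetLike.mem_coe, mem_rootsOfUnity, ← map_pow, pow_natAbs_eq_one.mpr hs, map_one]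
  · rintro ⟨u, hu, rfl⟩
    have hu : (u : Circle) ^ (∑ i, a i * v i).natAbs = 1 := (mem_rootsOfUnity' _ u).mp hu
    exact ⟨⟨u, rfl⟩, (torusChar_cocharHom a v u).trans (pow_natAbs_eq_one.mp hu)⟩

/-- for primitive `v` and `⟨a, v⟩ ≠ 0`, the intersection of the circle
subgroup `S_v = range (s ↦ (s^{v i})_i)` with `T'_a = ker χ_a` is a finite cyclic group
of order `|⟨a, v⟩|`; it is trivial iff `⟨a, v⟩ = ±1`. -/
theorem cocharacter_inter_kernel_cyclic_of_pairing
    (n : ℕ) (a v : Fin n → ℤ)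
    (hv : Finset.univ.gcd (fun i => (v i).natAbs) = 1)
    (hav : ∑ i, a i * v i ≠ 0) :
    Finite ↥((cocharHom v).range ⊓ torusKer a) ∧
      IsCyclic ↥((cocharHom v).range ⊓ torusKer a) ∧
      Nat.card ↥((cocharHom v).range ⊓ torusKer a) = (∑ i, a i * v i).natAbs ∧
      ((cocharHom v).range ⊓ torusKer a = ⊥ ↔
        (∑ i, a i * v i = 1 ∨ ∑ i, a i * v i = -1)) := by
  have : NeZero (∑ i, a i * v i).natAbs := ⟨Int.natAbs_ne_zero.mpr hav⟩
  let e : rootsOfUnity (∑ i, a i * v i).natAbs Circle ≃*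
      ↥((cocharHom v).range ⊓ torusKer a) :=
    (Subgroup.equivMapOfInjective _
      ((cocharHom v).comp (toUnits (G := Circle)).symm.toMonoidHom)
      ((cocharHom_injective hv).comp (toUnits (G := Circle)).symm.injective)).trans
      (MulEquiv.subgroupCongr (cocharHom_range_inf_torusKer a v).symm)
  have hcard : Nat.card ↥((cocharHom v).range ⊓ torusKer a) = (∑ i, a i * v i).natAbs :=
    (Nat.card_congr e.toEquiv).symm.trans
      (HasEnoughRootsOfUnity.natCard_rootsOfUnity Circle _)
  refine ⟨Nat.finite_of_card_ne_zero (hcard ▸ NeZero.ne _),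
    isCyclic_of_surjective e e.surjective, hcard, ?_⟩
  rw [← Subgroup.card_eq_one, hcard, Int.natAbs_eq_iff, Nat.cast_one]
end
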